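/- Let 1<p<∞. There exists a constant c depending only on p such that for every weight w on ℝ belonging to A_p^-(ℝ), the one-sided (left) Hardy–Littlewood maximal operator M⁻ is bounded on L^p_w(ℝ) with operator norm ‖M⁻‖_{L^p_w(ℝ)} ≤ c ‖w‖_{A_p^-(ℝ)}^{1/(p-1)}. -/

import Mathlib

open MeasureTheory Set Filter
open scoped ENNReal

noncomputable section

/-- A weight on `ℝ`: an a.e. positive, locally integrable function. -/
def IsWeight (w : ℝ → ℝ) : Prop :=
  (∀ᵐ x : ℝ, 0 < w x) ∧ MeasureTheory.LocallyIntegrable w MeasureTheory.volume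

/-- `∫_a^b w` as a lower integral. -/
def lintIoc (w : ℝ → ℝ) (a b : ℝ) : ℝ≥0∞ :=
  ∫⁻ t in Set.Ioc a b, ENNReal.ofReal (w t)

/-- Average `(1/(b-a)) ∫_a^b w`. -/
def avgIoc (w : ℝ → ℝ) (a b : ℝ) : ℝ≥0∞ :=
  (ENNReal.ofReal (b - a))⁻¹ * lintIoc w a b

/-- The one-sided Muckenhoupt `A_p^-` characteristic:
`sup_{x, h>0} ((1/h)∫_x^{x+h} w) ((1/h)∫_{x-h}^x w^{1-p'})^{p-1}` with `p' = p/(p-1)`. -/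
def apMinusChar (p : ℝ) (w : ℝ → ℝ) : ℝ≥0∞ :=
  ⨆ (x : ℝ) (h : ℝ) (_ : 0 < h),
    avgIoc w x (x + h) *
      avgIoc (fun t => w t ^ (1 - p / (p - 1))) (x - h) x ^ (p - 1)

/-- Weighted `L^p` "norm" `(∫ g^p w)^{1/p}` of an `ℝ≥0∞`-valued function. -/
def lnormW (p : ℝ) (w : ℝ → ℝ) (g : ℝ → ℝ≥0∞) : ℝ≥0∞ :=
  (∫⁻ x : ℝ, g x ^ p * ENNReal.ofReal (w x)) ^ (1 / p)

/-- One-sided (left) Hardy–Littlewood maximal operator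
`M⁻f(x) = sup_{h>0} (1/h) ∫_{x-h}^x |f|`. -/
def Mminus (f : ℝ → ℝ) (x : ℝ) : ℝ≥0∞ :=
  ⨆ (h : ℝ) (_ : 0 < h),
    (ENNReal.ofReal h)⁻¹ * ∫⁻ t in Set.Ioc (x - h) x, ENNReal.ofReal |f t|

lemma cover_overlap (T : Finset (ℝ × ℝ)) :
    ∃ S ⊆ T, (⋃ i ∈ S, Ioo i.1 i.2) = (⋃ i ∈ T, Ioo i.1 i.2) ∧
      ∀ x, (S.filter (fun i => x ∈ Ioo i.1 i.2)).card ≤ 2 := by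
  classical
  induction T using Finset.strongInduction with
  | H T ih =>
    by_cases h : ∀ x, (T.filter (fun i => x ∈ Ioo i.1 i.2)).card ≤ 2
    · exact ⟨T, subset_rfl, rfl, h⟩
    push Not at h
    obtain ⟨x, hx⟩ := h
    set F := T.filter (fun i => x ∈ Ioo i.1 i.2) with hF
    have hne : F.Nonempty := Finset.card_pos.1 (by omega)
    obtain ⟨i, hi, hi'⟩ := Finset.exists_min_image F (fun i => i.1) hne
    obtain ⟨j, hj, hj'⟩ := Finset.exists_max_image F (fun i => i.2) hne
    have : ((F.erase i).erase j).Nonempty := by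
      apply Finset.card_pos.1
      have h1 := Finset.pred_card_le_card_erase (s := F) (a := i)
      have h2 := Finset.pred_card_le_card_erase (s := F.erase i) (a := j)
      omega
    obtain ⟨k, hk⟩ := this
    simp only [Finset.mem_erase] at hk
    obtain ⟨hkj, hki, hkF⟩ := hk
    have hik := hi' k hkF
    have hjk := hj' k hkF
    simp only [hF, Finset.mem_filter, mem_Ioo] at hi hj hkF
    obtain ⟨S, hS, hSe, hSc⟩ := ih (T.erase k) (Finset.erase_ssubset hkF.1)
    refine ⟨S, hS.trans (Finset.erase_subset _ _), ?_, hSc⟩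
    rw [hSe]
    apply Subset.antisymm
    · exact biUnion_mono (fun a ha => Finset.mem_of_mem_erase ha) (fun _ _ => subset_rfl)
    · intro y hy
      simp only [mem_iUnion, exists_prop] at hy ⊢
      obtain ⟨l, hl, hy⟩ := hy
      by_cases hlk : l = k
      · subst hlk
        rcases lt_or_ge y i.2 with h | h
        · exact ⟨i, Finset.mem_erase.2 ⟨Ne.symm hki, hi.1⟩, lt_of_le_of_lt hik hy.1, h⟩
        · refine ⟨j, Finset.mem_erase.2 ⟨Ne.symm hkj, hj.1⟩, ?_, lt_of_lt_of_le hy.2 hjk⟩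
          linarith [hj.2.1, hi.2.2]
      · exact ⟨l, Finset.mem_erase.2 ⟨hlk, hl⟩, hy⟩

lemma weak_finite (μ ν : Measure ℝ) (t : ℝ≥0∞) (T : Finset (ℝ × ℝ))
    (h : ∀ i ∈ T, t * μ (Ioo i.1 i.2) ≤ ν (Ioo i.1 i.2)) :
    t * μ (⋃ i ∈ T, Ioo i.1 i.2) ≤ 2 * ν univ := by
  classical
  obtain ⟨S, hS, hSe, hSc⟩ := cover_overlap T
  rw [← hSe]
  calc t * μ (⋃ i ∈ S, Ioo i.1 i.2) ≤ t * ∑ i ∈ S, μ (Ioo i.1 i.2) := by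
        gcongr; exact measure_biUnion_finset_le _ _
    _ = ∑ i ∈ S, t * μ (Ioo i.1 i.2) := Finset.mul_sum _ _ _
    _ ≤ ∑ i ∈ S, ν (Ioo i.1 i.2) := Finset.sum_le_sum fun i hi => h i (hS hi)
    _ = ∑ i ∈ S, ∫⁻ x, (Ioo i.1 i.2).indicator 1 x ∂ν := by
        refine Finset.sum_congr rfl fun i _ => ?_
        rw [lintegral_indicator_one measurableSet_Ioo]
    _ = ∫⁻ x, ∑ i ∈ S, (Ioo i.1 i.2).indicator 1 x ∂ν := by
        rw [lintegral_finsetSum]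
        intro i _
        exact measurable_one.indicator measurableSet_Ioo
    _ ≤ ∫⁻ x, 2 ∂ν := by
        refine lintegral_mono fun x => ?_
        have : ∑ i ∈ S, (Ioo i.1 i.2).indicator (1 : ℝ → ℝ≥0∞) x
            = (S.filter (fun i => x ∈ Ioo i.1 i.2)).card := by
          rw [Finset.card_filter]
          push_cast
          refine Finset.sum_congr rfl fun i _ => ?_
          simp [indicator_apply]
        rw [this]
        have h2 := hSc x
        calc ((S.filter (fun i => x ∈ Ioo i.1 i.2)).card : ℝ≥0∞) ≤ ((2 : ℕ) : ℝ≥0∞) := Nat.cast_le.2 (by convert h2)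
          _ = 2 := by norm_num
    _ = 2 * ν univ := by simp

lemma weak_inf (μ ν : Measure ℝ) (t : ℝ≥0∞) (T : Set (ℝ × ℝ))
    (h : ∀ i ∈ T, t * μ (Ioo i.1 i.2) ≤ ν (Ioo i.1 i.2)) :
    t * μ (⋃ i ∈ T, Ioo i.1 i.2) ≤ 2 * ν univ := by
  classical
  obtain ⟨S, hST, hSc, hSe⟩ := TopologicalSpace.isOpen_biUnion_countable T
    (fun i => Ioo i.1 i.2) (fun i _ => isOpen_Ioo)
  rw [← hSe]
  have hcS : Countable S := hSc.to_subtype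
  have hU : (⋃ i ∈ S, Ioo i.1 i.2) = ⋃ F : Finset S, ⋃ i ∈ F, Ioo i.1.1 i.1.2 := by
    ext x
    simp only [mem_iUnion, exists_prop]
    constructor
    · rintro ⟨i, hi, hx⟩
      exact ⟨{⟨i, hi⟩}, ⟨i, hi⟩, by simp, hx⟩
    · rintro ⟨F, i, hi, hx⟩
      exact ⟨i, i.2, hx⟩
  rw [hU, Directed.measure_iUnion, ENNReal.mul_iSup]
  · refine iSup_le fun F => ?_
    have := weak_finite μ ν t (F.map (Function.Embedding.subtype _)) (by
      intro i hi
      simp only [Finset.mem_map] at hi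
      obtain ⟨a, _, rfl⟩ := hi
      exact h _ (hST a.2))
    simpa [Finset.mem_map, iUnion_exists] using this
  · refine directed_of_isDirected_le fun F G hFG => ?_
    exact biUnion_mono (fun a ha => hFG ha) (fun _ _ => subset_rfl)

/-- uncentered maximal function of `ν` relative to `μ`. -/
def MM (μ ν : Measure ℝ) (x : ℝ) : ℝ≥0∞ :=
  ⨆ (i : ℝ × ℝ) (_ : x ∈ Ioo i.1 i.2), ν (Ioo i.1 i.2) / μ (Ioo i.1 i.2)

lemma MM_lt_set (μ ν : Measure ℝ) (t : ℝ≥0∞) :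
    {x | t < MM μ ν x} = ⋃ i ∈ {i : ℝ × ℝ | t < ν (Ioo i.1 i.2) / μ (Ioo i.1 i.2)}, Ioo i.1 i.2 := by
  ext x
  simp only [MM, mem_ofPred_eq, lt_iSup_iff, mem_iUnion, exists_prop]
  exact ⟨fun ⟨i, h1, h2⟩ => ⟨i, h2, h1⟩, fun ⟨i, h1, h2⟩ => ⟨i, h2, h1⟩⟩

lemma MM_measurable (μ ν : Measure ℝ) : Measurable (MM μ ν) := by
  refine measurable_of_Ioi fun t => ?_
  change MeasurableSet {x | t < MM μ ν x}
  rw [MM_lt_set]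
  exact (isOpen_biUnion fun i _ => isOpen_Ioo).measurableSet

lemma MM_weak (μ : Measure ℝ) (φ : ℝ → ℝ≥0∞) (hφ : Measurable φ) (t : ℝ≥0∞)
    (ht : t ≠ 0) (ht' : t ≠ ∞) :
    t * μ {x | t < MM μ (μ.withDensity φ) x} ≤ 4 * μ.withDensity φ {x | t < 2 * φ x} := by
  have hms : MeasurableSet {x | t < 2 * φ x} := measurableSet_lt measurable_const (hφ.const_mul 2)
  rw [MM_lt_set]
  have key := weak_inf μ ((μ.withDensity φ).restrict {x | t < 2 * φ x}) (t / 2)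
    {i : ℝ × ℝ | t < μ.withDensity φ (Ioo i.1 i.2) / μ (Ioo i.1 i.2)} (by
    intro i hi
    have hi := ENNReal.mul_lt_of_lt_div hi
    set I := Ioo i.1 i.2
    have hI : MeasurableSet I := measurableSet_Ioo
    have hfin : μ I ≠ ∞ := by
      intro h
      rw [h, ENNReal.mul_top ht] at hi
      exact not_top_lt hi
    rw [Measure.restrict_apply hI]
    have h1 : μ.withDensity φ (I \ {x | t < 2 * φ x}) ≤ t / 2 * μ I := by
      rw [withDensity_apply _ (hI.diff hms)]
      calc ∫⁻ x in I \ {x | t < 2 * φ x}, φ x ∂μ ≤ ∫⁻ x in I \ {x | t < 2 * φ x}, t / 2 ∂μ := by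
            refine setLIntegral_mono measurable_const fun x hx => ?_
            have := hx.2
            simp only [mem_ofPred_eq, not_lt] at this
            rw [ENNReal.le_div_iff_mul_le (by simp) (by simp), mul_comm]
            exact this
        _ ≤ _ := by
            rw [setLIntegral_const]
            gcongr
            exact sdiff_subset
    have h2 := measure_inter_add_sdiff (μ := μ.withDensity φ) I hms
    have h3 : t / 2 * μ I + t / 2 * μ I = t * μ I := by
      rw [← add_mul, ENNReal.add_halves]
    rw [← h2, ← h3] at hi
    have h4 : t / 2 * μ I ≠ ∞ := ENNReal.mul_ne_top (ENNReal.div_ne_top ht' (by simp)) hfin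
    have h5 : t / 2 * μ I + t / 2 * μ I ≤
      (μ.withDensity φ (I ∩ {x | t < 2 * φ x})) + t / 2 * μ I := hi.le.trans (by gcongr)
    exact (ENNReal.add_le_add_iff_right h4).1 h5)
  rw [Measure.restrict_apply_univ] at key
  calc _ = 2 * (t / 2 * μ (⋃ i ∈ {i : ℝ × ℝ | t < μ.withDensity φ (Ioo i.1 i.2) / μ (Ioo i.1 i.2)}, Ioo i.1 i.2)) := by
        rw [← mul_assoc, ENNReal.mul_div_cancel (by simp) (by simp)]
    _ ≤ 2 * (2 * _) := by gcongr
    _ = _ := by rw [← mul_assoc]; norm_num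

lemma layer (μ : Measure ℝ) (F : ℝ → ℝ≥0∞) (hF : Measurable F) (hfin : ∀ᵐ x ∂μ, F x ≠ ∞)
    (q : ℝ) (hq : 0 < q) :
    ∫⁻ x, F x ^ q ∂μ = ENNReal.ofReal q *
      ∫⁻ t in Ioi (0:ℝ), μ {x | ENNReal.ofReal t < F x} * ENNReal.ofReal (t ^ (q - 1)) := by
  have := lintegral_rpow_eq_lintegral_meas_lt_mul μ (f := fun x => (F x).toReal)
    (ae_of_all _ fun x => ENNReal.toReal_nonneg) hF.ennreal_toReal.aemeasurable hq
  rw [lintegral_congr_ae (g := fun x => F x ^ q)] at this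
  · rw [this]
    congr 1
    refine setLIntegral_congr_fun measurableSet_Ioi fun t ht => ?_
    congr 1
    refine measure_congr ?_
    filter_upwards [hfin] with x hx
    have ht : (0:ℝ) < t := ht
    apply propext
    change t < (F x).toReal ↔ ENNReal.ofReal t < F x
    rw [ENNReal.ofReal_lt_iff_lt_toReal ht.le hx]
  · filter_upwards [hfin] with x hx
    rw [← ENNReal.ofReal_rpow_of_nonneg ENNReal.toReal_nonneg hq.le, ENNReal.ofReal_toReal hx]

lemma MM_strong (q : ℝ) (hq : 1 < q) (μ : Measure ℝ) (φ : ℝ → ℝ≥0∞) (hφ : Measurable φ) :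
    ∫⁻ x, MM μ (μ.withDensity φ) x ^ q ∂μ ≤
      (ENNReal.ofReal q * 4 * (ENNReal.ofReal (q-1))⁻¹ * 2 ^ (q - 1)) * ∫⁻ x, φ x ^ q ∂μ := by
  have hq0 : 0 < q := by linarith
  have hq1 : 0 < q - 1 := by linarith
  by_cases hI : ∫⁻ x, φ x ^ q ∂μ = ∞
  · rw [hI, ENNReal.mul_top]
    · exact le_top
    · simp [ENNReal.rpow_eq_zero_iff, hq0, hq1]
  have hfin : ∀ᵐ x ∂μ, φ x ≠ ∞ := by
    filter_upwards [ae_lt_top (hφ.pow_const q) hI] with x hx h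
    rw [h, ENNReal.top_rpow_of_pos hq0] at hx
    exact lt_irrefl _ hx
  set ν := μ.withDensity φ with hν
  set M := MM μ ν with hM
  have hMm : Measurable M := MM_measurable _ _
  -- truncation
  have trunc : ∀ n : ℕ, ∫⁻ x, (min (M x) n) ^ q ∂μ ≤
      (ENNReal.ofReal q * 4 * (ENNReal.ofReal (q-1))⁻¹ * 2 ^ (q - 1)) * ∫⁻ x, φ x ^ q ∂μ := by
    intro n
    have h2 := layer ν (fun x => 2 * φ x) (hφ.const_mul 2) (by
      filter_upwards [(withDensity_absolutelyContinuous μ φ) hfin] with x hx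
      exact ENNReal.mul_ne_top (by simp) hx) (q - 1) hq1
    have h3 : ∫⁻ x, (2 * φ x) ^ (q - 1) ∂ν = 2 ^ (q - 1) * ∫⁻ x, φ x ^ q ∂μ := by
      rw [hν, lintegral_withDensity_eq_lintegral_mul μ hφ ((hφ.const_mul 2).pow_const _),
        ← lintegral_const_mul _ (hφ.pow_const _)]
      refine lintegral_congr fun x => ?_
      simp only [Pi.mul_apply]
      rw [ENNReal.mul_rpow_of_nonneg _ _ hq1.le, mul_left_comm]
      congr 1
      nth_rewrite 1 [← ENNReal.rpow_one (φ x)]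
      rw [← ENNReal.rpow_add_of_nonneg _ _ zero_le_one hq1.le]
      congr 1; ring
    rw [h3] at h2
    rw [layer μ (fun x => min (M x) n) (hMm.min measurable_const)
      (ae_of_all _ fun x => ne_top_of_le_ne_top (ENNReal.natCast_ne_top n) (min_le_right _ _)) q hq0]
    have h4 : ∫⁻ t in Ioi (0:ℝ), μ {x | ENNReal.ofReal t < min (M x) n} * ENNReal.ofReal (t ^ (q - 1))
        ≤ 4 * ∫⁻ t in Ioi (0:ℝ), ν {x | ENNReal.ofReal t < 2 * φ x} * ENNReal.ofReal (t ^ (q - 1 - 1)) := by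
      rw [← lintegral_const_mul' _ _ (by simp)]
      refine setLIntegral_mono' measurableSet_Ioi fun t ht => ?_
      have ht : (0:ℝ) < t := ht
      have hw := MM_weak μ φ hφ (ENNReal.ofReal t) (by simpa using ht) (by simp)
      have e : t ^ (q - 1) = t * t ^ (q - 1 - 1) := by
        nth_rewrite 2 [← Real.rpow_one t]
        rw [← Real.rpow_add ht]; congr 1; ring
      rw [e, ENNReal.ofReal_mul ht.le, ← mul_assoc, ← mul_assoc]
      refine mul_le_mul_left ?_ _
      rw [mul_comm]
      refine le_trans ?_ hw
      gcongr
      exact min_le_left _ _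
    have h5 : ∫⁻ t in Ioi (0:ℝ), ν {x | ENNReal.ofReal t < 2 * φ x} * ENNReal.ofReal (t ^ (q - 1 - 1))
        = (ENNReal.ofReal (q-1))⁻¹ * (2 ^ (q - 1) * ∫⁻ x, φ x ^ q ∂μ) := by
      rw [h2, ← mul_assoc, ENNReal.inv_mul_cancel (by simpa using hq) (by simp), one_mul]
    rw [h5] at h4
    calc _ ≤ ENNReal.ofReal q * (4 * ((ENNReal.ofReal (q-1))⁻¹ * (2 ^ (q - 1) * ∫⁻ x, φ x ^ q ∂μ))) := by
          gcongr
      _ = _ := by ring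
  have hsup : ∀ x, M x ^ q = ⨆ n : ℕ, (min (M x) n) ^ q := by
    intro x
    have e1 := (ENNReal.orderIsoRpow q hq0).map_iSup (fun n : ℕ => min (M x) n)
    simp only [ENNReal.orderIsoRpow_apply] at e1
    rw [← e1]
    congr 1
    have e2 := inf_iSup_eq (M x) (fun n : ℕ => (n : ℝ≥0∞))
    rw [ENNReal.iSup_natCast] at e2
    simpa using e2
  simp_rw [hsup]
  rw [lintegral_iSup]
  · exact iSup_le trunc
  · intro n; exact (hMm.min measurable_const).pow_const _
  · intro m n hmn x
    dsimp only
    gcongr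

lemma wd_Ioo_pos (W : ℝ → ℝ≥0∞) (hW : Measurable W) (h0 : ∀ x, W x ≠ 0) (a b : ℝ) (hab : a < b) :
    volume.withDensity W (Ioo a b) ≠ 0 := by
  intro h
  rw [withDensity_apply_eq_zero' hW.aemeasurable] at h
  have : {x | W x ≠ 0} ∩ Ioo a b = Ioo a b := by
    ext x; simp [h0 x]
  rw [this, Real.volume_Ioo] at h
  simp only [ENNReal.ofReal_eq_zero] at h
  linarith

lemma wd_Ioo_Ioc (W : ℝ → ℝ≥0∞) (a b : ℝ) :
    volume.withDensity W (Ioo a b) = ∫⁻ t in Ioc a b, W t := by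
  rw [withDensity_apply _ measurableSet_Ioo, restrict_Ioo_eq_restrict_Ioc]

lemma core_point (p : ℝ) (hp : 1 < p) (W : ℝ → ℝ≥0∞) (hW : Measurable W) (h0 : ∀ x, W x ≠ 0)
    (ht : ∀ x, W x ≠ ∞) (hloc : ∀ a b, ∫⁻ t in Ioc a b, W t ≠ ∞) (K : ℝ≥0∞) (hK : K ≠ ∞)
    (hA : ∀ x h : ℝ, 0 < h → (∫⁻ t in Ioc x (x + h), W t) *
      (∫⁻ t in Ioc (x - h) x, W t ^ (-(1 / (p - 1)))) ^ (p - 1) ≤ K * ENNReal.ofReal h ^ p)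
    (f : ℝ → ℝ≥0∞) (x h : ℝ) (hh : 0 < h) :
    (ENNReal.ofReal h)⁻¹ * ∫⁻ t in Ioc (x - h) x, f t ≤
      (2 ^ p * K * MM (volume.withDensity W) ((volume.withDensity W).withDensity
        (fun y => MM (volume.withDensity (fun t => W t ^ (-(1 / (p - 1)))))
          (volume.withDensity f) y ^ (p - 1) / W y)) x) ^ (1 / (p - 1)) := by
  have hr : 0 < p - 1 := by linarith
  set S : ℝ → ℝ≥0∞ := fun t => W t ^ (-(1 / (p - 1))) with hS
  have hSm : Measurable S := hW.pow_const _
  have hS0 : ∀ x, S x ≠ 0 := by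
    intro x
    simp [hS, ENNReal.rpow_eq_zero_iff, h0 x, ht x]
  set ms := volume.withDensity S with hms
  set mf := volume.withDensity f with hmf
  set mw := volume.withDensity W with hmw
  set φ := MM ms mf with hφ
  have hφm : Measurable φ := MM_measurable _ _
  set P := MM mw (mw.withDensity (fun y => φ y ^ (p - 1) / W y)) x with hP
  have hmv : mw.withDensity (fun y => φ y ^ (p - 1) / W y) =
      volume.withDensity (fun y => φ y ^ (p - 1)) := by
    have hm : Measurable (fun y => φ y ^ (p - 1) / W y) := (hφm.pow_const _).div hW
    rw [hmw, ← withDensity_mul _ hW hm]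
    congr 1
    ext y
    simp only [Pi.mul_apply]
    rw [ENNReal.mul_div_cancel (h0 y) (ht y)]
  set Q := (2 ^ p * K * P) ^ (1 / (p - 1)) with hQ
  have hQp : Q ^ (p - 1) = 2 ^ p * K * P := by
    rw [hQ, ← ENNReal.rpow_mul, one_div_mul_cancel hr.ne', ENNReal.rpow_one]
  have hfinS : ∀ (b l : ℝ), 0 < l → ∫⁻ t in Ioc (b - l) b, S t ≠ ∞ := by
    intro b l hl hc
    have := hA b l hl
    rw [hc, ENNReal.top_rpow_of_pos hr, ENNReal.mul_top] at this
    · refine (ENNReal.mul_ne_top hK ?_) (top_le_iff.1 this)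
      exact ENNReal.rpow_ne_top_of_nonneg (by linarith) ENNReal.ofReal_ne_top
    · rw [← wd_Ioo_Ioc]
      exact wd_Ioo_pos W hW h0 _ _ (by linarith)
  set lam := mf (Ioo (x - h) x) / ms (Ioo (x - h) x) with hlam
  have hms0 : ms (Ioo (x - h) x) ≠ 0 := wd_Ioo_pos S hSm hS0 _ _ (by linarith)
  have hmst : ms (Ioo (x - h) x) ≠ ∞ := by
    rw [hms, wd_Ioo_Ioc]; exact hfinS _ _ hh
  have hφlam : ∀ y ∈ Ioo (x - h) x, lam ≤ φ y := by
    intro y hy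
    rw [hφ, hlam]
    unfold MM
    exact le_iSup₂_of_le (x - h, x) hy le_rfl
  -- key local estimate
  have key : ∀ l : ℝ, 0 < l → l ≤ h → lam * ms (Ioc (x - l - 2 * l) (x - l)) ≤ Q * ENNReal.ofReal l := by
    intro l hl hlh
    have hA1 := hA (x - l) (2 * l) (by linarith)
    have es : ms (Ioc (x - l - 2 * l) (x - l)) = ∫⁻ t in Ioc (x - l - 2 * l) (x - l), S t :=
      withDensity_apply _ measurableSet_Ioc
    rw [es]
    set s := ∫⁻ t in Ioc (x - l - 2 * l) (x - l), S t with hs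
    rw [← wd_Ioo_Ioc] at hA1
    have hV0 : mw (Ioo (x - l) (x - l + 2 * l)) ≠ 0 := wd_Ioo_pos W hW h0 _ _ (by linarith)
    have hVt : mw (Ioo (x - l) (x - l + 2 * l)) ≠ ∞ := by
      rw [hmw, wd_Ioo_Ioc]; exact hloc _ _
    have h1 : (mw.withDensity (fun y => φ y ^ (p - 1) / W y)) (Ioo (x - l) (x - l + 2 * l)) ≤
        P * mw (Ioo (x - l) (x - l + 2 * l)) := by
      rw [← ENNReal.div_le_iff hV0 hVt, hP]
      unfold MM
      exact le_iSup₂_of_le (f := fun (i : ℝ × ℝ) (_ : x ∈ Ioo i.1 i.2) =>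
        (mw.withDensity (fun y => φ y ^ (p - 1) / W y)) (Ioo i.1 i.2) / mw (Ioo i.1 i.2))
        (x - l, x - l + 2 * l) ⟨by simp; linarith, by simp; linarith⟩ le_rfl
    have h2 : lam ^ (p - 1) * ENNReal.ofReal l ≤
        (mw.withDensity (fun y => φ y ^ (p - 1) / W y)) (Ioo (x - l) (x - l + 2 * l)) := by
      rw [hmv, withDensity_apply _ measurableSet_Ioo]
      calc lam ^ (p - 1) * ENNReal.ofReal l = ∫⁻ y in Ioo (x - l) x, lam ^ (p - 1) := by
            rw [setLIntegral_const, Real.volume_Ioo]; congr 2; ring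
        _ ≤ ∫⁻ y in Ioo (x - l) x, φ y ^ (p - 1) := by
            refine setLIntegral_mono' measurableSet_Ioo fun y hy => ?_
            exact ENNReal.rpow_le_rpow (hφlam y ⟨by linarith [hy.1], hy.2⟩) hr.le
        _ ≤ _ := lintegral_mono_set (Ioo_subset_Ioo le_rfl (by linarith))
    have hl0 : ENNReal.ofReal l ≠ 0 := by simpa using hl
    have h3 : (lam * s) ^ (p - 1) * ENNReal.ofReal l ≤
        (Q * ENNReal.ofReal l) ^ (p - 1) * ENNReal.ofReal l := by
      rw [ENNReal.mul_rpow_of_nonneg _ _ hr.le, ENNReal.mul_rpow_of_nonneg _ _ hr.le, hQp]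
      calc lam ^ (p - 1) * s ^ (p - 1) * ENNReal.ofReal l
          = (lam ^ (p - 1) * ENNReal.ofReal l) * s ^ (p - 1) := by ring
        _ ≤ (P * mw (Ioo (x - l) (x - l + 2 * l))) * s ^ (p - 1) := by
            exact mul_le_mul_left (h2.trans h1) _
        _ = P * (mw (Ioo (x - l) (x - l + 2 * l)) * s ^ (p - 1)) := by ring
        _ ≤ P * (K * ENNReal.ofReal (2 * l) ^ p) := by gcongr
        _ = P * (K * (2 ^ p * (ENNReal.ofReal l ^ (p - 1) * ENNReal.ofReal l))) := by
            congr 2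
            rw [ENNReal.ofReal_mul (by norm_num), ENNReal.mul_rpow_of_nonneg _ _ (by linarith)]
            congr 1
            · simp
            · nth_rewrite 3 [← ENNReal.rpow_one (ENNReal.ofReal l)]
              rw [← ENNReal.rpow_add_of_nonneg _ _ hr.le zero_le_one]
              congr 1; ring
        _ = _ := by ring
    have h4 := (ENNReal.mul_le_mul_iff_left hl0 ENNReal.ofReal_ne_top).1 h3
    exact (ENNReal.rpow_le_rpow_iff hr).1 h4
  have hcov : Ioo (x - h) x ⊆ ⋃ k : ℕ, Ioc (x - h / 2 / 2 ^ k - 2 * (h / 2 / 2 ^ k)) (x - h / 2 / 2 ^ k) := by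
    intro y hy
    obtain ⟨n, hn1, hn2⟩ := exists_nat_pow_near_of_lt_one (x := (x - y) / h) (y := (1/2 : ℝ))
      (div_pos (by linarith [hy.2]) hh) ((div_le_one hh).2 (by linarith [hy.1])) (by norm_num) (by norm_num)
    rw [lt_div_iff₀ hh] at hn1
    rw [div_le_iff₀ hh] at hn2
    have e : h / 2 / 2 ^ n = (1/2 : ℝ) ^ (n + 1) * h := by
      rw [one_div, inv_pow, pow_succ]; field_simp
    have e2 : (1/2 : ℝ) ^ n * h = 2 * (h / 2 / 2 ^ n) := by
      rw [one_div, inv_pow]; field_simp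
    have e3 : 0 < h / 2 / 2 ^ n := by positivity
    refine mem_iUnion.2 ⟨n, ?_, ?_⟩ <;> linarith
  have hsum : lam * ms (Ioo (x - h) x) ≤ Q * ENNReal.ofReal h := by
    calc lam * ms (Ioo (x - h) x)
        ≤ lam * ∑' k : ℕ, ms (Ioc (x - h / 2 / 2 ^ k - 2 * (h / 2 / 2 ^ k)) (x - h / 2 / 2 ^ k)) := by
          gcongr
          exact (measure_mono hcov).trans (measure_iUnion_le _)
      _ = ∑' k : ℕ, lam * ms (Ioc (x - h / 2 / 2 ^ k - 2 * (h / 2 / 2 ^ k)) (x - h / 2 / 2 ^ k)) :=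
          ENNReal.tsum_mul_left.symm
      _ ≤ ∑' k : ℕ, Q * ENNReal.ofReal (h / 2 / 2 ^ k) := by
          refine ENNReal.tsum_le_tsum fun k => key _ (by positivity) ?_
          rw [div_div]
          refine div_le_self hh.le ?_
          have : (1:ℝ) ≤ 2 ^ k := one_le_pow₀ (by norm_num)
          linarith
      _ = Q * ENNReal.ofReal h := by
          rw [ENNReal.tsum_mul_left, ← ENNReal.ofReal_tsum_of_nonneg (fun k => by positivity)
            (summable_geometric_two' h), tsum_geometric_two' h]
  rw [hlam, ENNReal.div_mul_cancel hms0 hmst] at hsum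
  rw [← wd_Ioo_Ioc, mul_comm, ← div_eq_mul_inv]
  exact ENNReal.div_le_of_le_mul hsum

def CC (q : ℝ) : ℝ≥0∞ := ENNReal.ofReal q * 4 * (ENNReal.ofReal (q-1))⁻¹ * 2 ^ (q - 1)

lemma CC_ne_top (q : ℝ) (hq : 1 < q) : CC q ≠ ∞ := by
  unfold CC
  refine ENNReal.mul_ne_top (ENNReal.mul_ne_top (ENNReal.mul_ne_top (by simp) (by simp)) ?_) ?_
  · simpa using hq
  · exact ENNReal.rpow_ne_top_of_nonneg (by linarith) (by simp)

lemma core (p : ℝ) (hp : 1 < p) (W : ℝ → ℝ≥0∞) (hW : Measurable W) (h0 : ∀ x, W x ≠ 0)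
    (ht : ∀ x, W x ≠ ∞) (hloc : ∀ a b, ∫⁻ t in Ioc a b, W t ≠ ∞) (K : ℝ≥0∞) (hK : K ≠ ∞)
    (hA : ∀ x h : ℝ, 0 < h → (∫⁻ t in Ioc x (x + h), W t) *
      (∫⁻ t in Ioc (x - h) x, W t ^ (-(1 / (p - 1)))) ^ (p - 1) ≤ K * ENNReal.ofReal h ^ p)
    (f : ℝ → ℝ≥0∞) (hf : Measurable f) :
    ∫⁻ x, (⨆ (h : ℝ) (_ : 0 < h), (ENNReal.ofReal h)⁻¹ * ∫⁻ t in Ioc (x - h) x, f t) ^ p * W x ≤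
      (2 ^ p * K) ^ (p / (p - 1)) * (CC (p / (p - 1)) * CC p) * ∫⁻ x, f x ^ p * W x := by
  have hr : 0 < p - 1 := by linarith
  have hp0 : 0 < p := by linarith
  have hp' : 1 < p / (p - 1) := by rw [lt_div_iff₀ hr]; linarith
  have hpt := core_point p hp W hW h0 ht hloc K hK hA f
  set S : ℝ → ℝ≥0∞ := fun t => W t ^ (-(1 / (p - 1))) with hS
  have hSm : Measurable S := hW.pow_const _
  have hS0 : ∀ x, S x ≠ 0 := by
    intro x
    simp [hS, ENNReal.rpow_eq_zero_iff, h0 x, ht x]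
  have hSt : ∀ x, S x ≠ ∞ := by
    intro x
    simp [hS, ENNReal.rpow_eq_top_iff, h0 x, ht x]
  set φ := MM (volume.withDensity S) (volume.withDensity f) with hφ
  have hφm : Measurable φ := MM_measurable _ _
  set Φ := fun y => φ y ^ (p - 1) / W y with hΦ
  have hΦm : Measurable Φ := (hφm.pow_const _).div hW
  set P := MM (volume.withDensity W) ((volume.withDensity W).withDensity Φ) with hP
  have hPm : Measurable P := MM_measurable _ _
  have s1 := MM_strong (p / (p - 1)) hp' (volume.withDensity W) Φ hΦm
  have hgm : Measurable (fun x => f x / S x) := hf.div hSm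
  have hg : volume.withDensity f = (volume.withDensity S).withDensity (fun x => f x / S x) := by
    rw [← withDensity_mul _ hSm hgm]
    congr 1
    ext y
    simp only [Pi.mul_apply]
    rw [ENNReal.mul_div_cancel (hS0 y) (hSt y)]
  have s2 := MM_strong p hp (volume.withDensity S) (fun x => f x / S x) hgm
  rw [← hg] at s2
  change _ ≤ CC _ * _ at s1 s2
  rw [lintegral_withDensity_eq_lintegral_mul _ hW ((MM_measurable _ _).pow_const _),
    lintegral_withDensity_eq_lintegral_mul _ hW (hΦm.pow_const _)] at s1
  rw [lintegral_withDensity_eq_lintegral_mul _ hSm ((MM_measurable _ _).pow_const _),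
    lintegral_withDensity_eq_lintegral_mul _ hSm (hgm.pow_const _)] at s2
  have e1 : ∀ y, (W * fun a => Φ a ^ (p / (p - 1))) y = (S * fun a => φ a ^ p) y := by
    intro y
    simp only [Pi.mul_apply, hΦ, hS]
    rw [ENNReal.div_rpow_of_nonneg _ _ (by linarith), ← ENNReal.rpow_mul,
      mul_div_cancel₀ _ hr.ne', div_eq_mul_inv, ← ENNReal.rpow_neg, mul_left_comm, mul_comm]
    congr 1
    nth_rewrite 1 [← ENNReal.rpow_one (W y)]
    rw [← ENNReal.rpow_add _ _ (h0 y) (ht y)]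
    congr 1
    field_simp
    ring
  have e2 : ∀ y, (S * fun a => (f a / S a) ^ p) y = f y ^ p * W y := by
    intro y
    simp only [Pi.mul_apply, hS]
    rw [ENNReal.div_rpow_of_nonneg _ _ hp0.le, ← ENNReal.rpow_mul, div_eq_mul_inv (f y ^ p),
      ← ENNReal.rpow_neg, mul_left_comm, ← ENNReal.rpow_add _ _ (h0 y) (ht y)]
    congr 1
    nth_rewrite 2 [← ENNReal.rpow_one (W y)]
    congr 1
    field_simp
    ring
  rw [lintegral_congr e1] at s1
  rw [lintegral_congr e2] at s2
  calc _ ≤ ∫⁻ x, (2 ^ p * K) ^ (p / (p - 1)) * (W * fun a => P a ^ (p / (p - 1))) x := by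
        refine lintegral_mono fun x => ?_
        have := iSup₂_le (hpt x)
        calc _ ≤ ((2 ^ p * K * P x) ^ (1 / (p - 1))) ^ p * W x := by gcongr
          _ = _ := by
            rw [← ENNReal.rpow_mul, ENNReal.mul_rpow_of_nonneg _ _ (by positivity)]
            simp only [Pi.mul_apply]
            rw [one_div_mul_eq_div]
            ring
    _ = (2 ^ p * K) ^ (p / (p - 1)) * ∫⁻ x, (W * fun a => P a ^ (p / (p - 1))) x := by
        rw [lintegral_const_mul _ (hW.mul (hPm.pow_const _))]
    _ ≤ (2 ^ p * K) ^ (p / (p - 1)) * (CC (p / (p - 1)) * (CC p * ∫⁻ x, f x ^ p * W x)) := by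
        gcongr
        exact s1.trans (by gcongr)
    _ = _ := by ring

/-- Buckley-type sharp bound for the one-sided maximal operator `M⁻`:
`‖M⁻‖_{L^p_w} ≤ c ‖w‖_{A_p^-}^{1/(p-1)}`. -/
theorem stmt1 (p : ℝ) (hp : 1 < p) :
    ∃ c : ℝ, 0 < c ∧
      ∀ w : ℝ → ℝ, IsWeight w → apMinusChar p w ≠ ∞ →
        ∀ f : ℝ → ℝ,
          lnormW p w (Mminus f) ≤
            ENNReal.ofReal c * apMinusChar p w ^ (1 / (p - 1)) *
              lnormW p w (fun x => ENNReal.ofReal |f x|) := by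
  have hr : 0 < p - 1 := by linarith
  have hp0 : 0 < p := by linarith
  have hp' : 1 < p / (p - 1) := by rw [lt_div_iff₀ hr]; linarith
  set D : ℝ≥0∞ := ((2 ^ p) ^ (p / (p - 1)) * (CC (p / (p - 1)) * CC p)) ^ (1 / p) with hD
  have hDt : D ≠ ∞ := by
    refine ENNReal.rpow_ne_top_of_nonneg (by positivity) (ENNReal.mul_ne_top ?_
      (ENNReal.mul_ne_top (CC_ne_top _ hp') (CC_ne_top _ hp)))
    exact ENNReal.rpow_ne_top_of_nonneg (by positivity)
      (ENNReal.rpow_ne_top_of_nonneg hp0.le (by simp))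
  refine ⟨D.toReal + 1, by positivity, ?_⟩
  rintro w ⟨hwpos, hwloc⟩ hK f
  set K := apMinusChar p w with hKdef
  -- measurable positive representative
  obtain ⟨w', hw'm, hw'pos, hww'⟩ : ∃ w' : ℝ → ℝ, Measurable w' ∧ (∀ x, 0 < w' x) ∧ w =ᵐ[volume] w' := by
    have hm : AEMeasurable w volume := hwloc.aestronglyMeasurable.aemeasurable
    refine ⟨fun x => if 0 < hm.mk w x then hm.mk w x else 1, ?_, ?_, ?_⟩
    · exact Measurable.ite (measurableSet_lt measurable_const hm.measurable_mk) hm.measurable_mk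
        measurable_const
    · intro x
      dsimp only
      split_ifs with h
      · exact h
      · exact one_pos
    · filter_upwards [hwpos, hm.ae_eq_mk] with x h1 h2
      rw [if_pos (h2 ▸ h1), h2]
  set W : ℝ → ℝ≥0∞ := fun x => ENNReal.ofReal (w' x) with hWdef
  have hWm : Measurable W := hw'm.ennreal_ofReal
  have hW0 : ∀ x, W x ≠ 0 := fun x => by simpa [hWdef] using hw'pos x
  have hWt : ∀ x, W x ≠ ∞ := fun x => ENNReal.ofReal_ne_top
  have hwW : (fun x => ENNReal.ofReal (w x)) =ᵐ[volume] W := by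
    filter_upwards [hww'] with x hx
    rw [hx]
  have hsS : (fun x => ENNReal.ofReal (w x ^ (1 - p / (p - 1)))) =ᵐ[volume]
      fun x => W x ^ (-(1 / (p - 1))) := by
    filter_upwards [hww'] with x hx
    rw [hx, hWdef, ENNReal.ofReal_rpow_of_pos (hw'pos x)]
    congr 2
    field_simp
    ring
  have hloc : ∀ a b, ∫⁻ t in Ioc a b, W t ≠ ∞ := by
    intro a b
    rw [← lintegral_congr_ae (ae_restrict_of_ae hwW)]
    have h1 : IntegrableOn w (Ioc a b) :=
      (hwloc.integrableOn_isCompact isCompact_Icc).mono_set Ioc_subset_Icc_self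
    exact (lt_of_le_of_lt (lintegral_mono fun x => Real.ofReal_le_enorm (w x)) h1.2).ne
  have hA : ∀ x h : ℝ, 0 < h → (∫⁻ t in Ioc x (x + h), W t) *
      (∫⁻ t in Ioc (x - h) x, W t ^ (-(1 / (p - 1)))) ^ (p - 1) ≤ K * ENNReal.ofReal h ^ p := by
    intro x h hh
    have h1 : avgIoc w x (x + h) *
      avgIoc (fun t => w t ^ (1 - p / (p - 1))) (x - h) x ^ (p - 1) ≤ K := by
      rw [hKdef]
      unfold apMinusChar
      exact le_iSup_of_le x (le_iSup₂_of_le h hh le_rfl)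
    unfold avgIoc lintIoc at h1
    rw [lintegral_congr_ae (ae_restrict_of_ae hwW), lintegral_congr_ae (ae_restrict_of_ae hsS),
      add_sub_cancel_left, sub_sub_cancel, ENNReal.mul_rpow_of_nonneg _ _ hr.le] at h1
    have hh0 : ENNReal.ofReal h ≠ 0 := by simpa using hh
    have hht : ENNReal.ofReal h ≠ ∞ := ENNReal.ofReal_ne_top
    have e : (ENNReal.ofReal h)⁻¹ * (ENNReal.ofReal h)⁻¹ ^ (p - 1) = (ENNReal.ofReal h ^ p)⁻¹ := by
      nth_rewrite 1 [← ENNReal.rpow_one (ENNReal.ofReal h)⁻¹]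
      rw [← ENNReal.rpow_add_of_nonneg _ _ zero_le_one hr.le, ← ENNReal.inv_rpow]
      congr 1; ring
    rw [mul_mul_mul_comm, e, mul_comm, ← div_eq_mul_inv, ENNReal.div_le_iff] at h1
    · exact h1
    · simp [ENNReal.rpow_eq_zero_iff, hh0, hht]
    · exact ENNReal.rpow_ne_top_of_nonneg hp0.le hht
  obtain ⟨g, hgm, hgle, hgeq⟩ := exists_measurable_le_forall_setLIntegral_eq volume
    (fun x => ENNReal.ofReal |f x|)
  have hcore := core p hp W hWm hW0 hWt hloc K hK hA g hgm
  have hM : ∀ x, Mminus f x =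
      ⨆ (h : ℝ) (_ : 0 < h), (ENNReal.ofReal h)⁻¹ * ∫⁻ t in Ioc (x - h) x, g t := by
    intro x
    unfold Mminus
    simp_rw [hgeq]
  have hL : ∫⁻ x, Mminus f x ^ p * ENNReal.ofReal (w x) ≤
      (2 ^ p * K) ^ (p / (p - 1)) * (CC (p / (p - 1)) * CC p) *
        ∫⁻ x, ENNReal.ofReal |f x| ^ p * ENNReal.ofReal (w x) := by
    calc ∫⁻ x, Mminus f x ^ p * ENNReal.ofReal (w x) = ∫⁻ x, Mminus f x ^ p * W x := by
          refine lintegral_congr_ae ?_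
          filter_upwards [hwW] with x hx
          rw [hx]
      _ ≤ (2 ^ p * K) ^ (p / (p - 1)) * (CC (p / (p - 1)) * CC p) * ∫⁻ x, g x ^ p * W x := by
          simp_rw [hM]
          exact hcore
      _ ≤ (2 ^ p * K) ^ (p / (p - 1)) * (CC (p / (p - 1)) * CC p) *
          ∫⁻ x, ENNReal.ofReal |f x| ^ p * W x := by
          gcongr with x
          exact hgle x
      _ = _ := by
          congr 1
          refine lintegral_congr_ae ?_
          filter_upwards [hwW] with x hx
          rw [hx]
  unfold lnormW
  have hip : 0 ≤ 1 / p := by positivity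
  calc _ ≤ _ := ENNReal.rpow_le_rpow hL hip
    _ = D * K ^ (1 / (p - 1)) *
        (∫⁻ x, ENNReal.ofReal |f x| ^ p * ENNReal.ofReal (w x)) ^ (1 / p) := by
        rw [ENNReal.mul_rpow_of_nonneg _ _ hip]
        congr 1
        rw [ENNReal.mul_rpow_of_nonneg _ _ (by positivity : 0 ≤ p / (p - 1)), mul_right_comm,
          ENNReal.mul_rpow_of_nonneg _ _ hip, ← ENNReal.rpow_mul K]
        congr 2
        field_simp
    _ ≤ _ := by
        gcongr
        rw [← ENNReal.ofReal_toReal hDt]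
        refine ENNReal.ofReal_le_ofReal ?_
        rw [ENNReal.ofReal_toReal hDt]
        linarith

end
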